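/- Let B₁,…,B_m be n×n complex matrices. Then the following are equivalent: (i) for every x ∈ ℂᵐ with ∑_{j=1}^m |x_j|² ≤ 1, ‖∑_{j=1}^m x_j B_j‖_op ≤ 1; (ii) for every unit vector β ∈ ℂⁿ, the m×m complex matrix whose (i,j) entry is δ_{ij} − ⟨B_i B_j* β, β⟩ is positive semidefinite, where B* denotes conjugate transpose and δ_{ij} is the Kronecker delta. -/

import Mathlib

open scoped Kronecker

/-- The operator norm of a complex matrix, viewed as a linear map between
Euclidean spaces (standard `ℓ²` norms). -/
noncomputable def opNorm {m n : Type*} [Fintype m] [Fintype n] [DecidableEq n]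
    (M : Matrix m n ℂ) : ℝ :=
  ‖LinearMap.toContinuousLinearMap (Matrix.toEuclideanLin M)‖

open Matrix
open scoped ComplexOrder

theorem opNorm_le_iff {m n : Type*} [Fintype m] [Fintype n] [DecidableEq n]
    (M : Matrix m n ℂ) {c : ℝ} (hc : 0 ≤ c) :
    opNorm M ≤ c ↔ ∀ b : EuclideanSpace ℂ n, ‖WithLp.toLp 2 (M *ᵥ b.ofLp)‖ ≤ c * ‖b‖ :=
  ContinuousLinearMap.opNorm_le_iff hc

open scoped Matrix.Norms.L2Operator in
theorem opNorm_conjTranspose {m n : Type*} [Fintype m] [Fintype n] [DecidableEq m]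
    [DecidableEq n] (M : Matrix m n ℂ) : opNorm Mᴴ = opNorm M :=
  l2_opNorm_conjTranspose M

theorem star_dotProduct_self_eq_norm_sq {n : Type*} [Fintype n] (v : n → ℂ) :
    star v ⬝ᵥ v = ((‖WithLp.toLp 2 v‖ ^ 2 : ℝ) : ℂ) := by
  simp [EuclideanSpace.norm_sq_eq, dotProduct, Complex.conj_mul']

theorem posSemidef_one_sub_conjTranspose_mul_self_iff {m n : Type*} [Fintype m] [Fintype n]
    [DecidableEq m] (W : Matrix n m ℂ) :
    (1 - Wᴴ * W).PosSemidef ↔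
      ∀ v : m → ℂ, ‖WithLp.toLp 2 (W *ᵥ v)‖ ≤ ‖WithLp.toLp 2 v‖ := by
  have key (v : m → ℂ) : 0 ≤ star v ⬝ᵥ ((1 - Wᴴ * W) *ᵥ v) ↔
      ‖WithLp.toLp 2 (W *ᵥ v)‖ ≤ ‖WithLp.toLp 2 v‖ := by
    rw [sub_mulVec, one_mulVec, dotProduct_sub, ← mulVec_mulVec, dotProduct_mulVec (star v),
      ← star_mulVec, star_dotProduct_self_eq_norm_sq, star_dotProduct_self_eq_norm_sq,
      sub_nonneg, Complex.real_le_real, sq_le_sq₀ (norm_nonneg _) (norm_nonneg _)]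
  refine ⟨fun h v => (key v).1 (h.dotProduct_mulVec_nonneg v), fun h => ?_⟩
  exact .of_dotProduct_mulVec_nonneg
    (isHermitian_one.sub (isHermitian_conjTranspose_mul_self W)) fun v => (key v).2 (h v)

theorem of_conjTranspose_mulVec_mulVec {ι m n : Type*} [Fintype ι] [Fintype m] [Fintype n]
    (B : ι → Matrix m n ℂ) (β : m → ℂ) (v : ι → ℂ) :
    (of fun k j => ((B j)ᴴ *ᵥ β) k) *ᵥ v = (∑ j, star v j • B j)ᴴ *ᵥ β := by
  rw [conjTranspose_sum, sum_mulVec]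
  ext k
  rw [Finset.sum_apply, mulVec, dotProduct]
  refine Finset.sum_congr rfl fun j _ => ?_
  simp [conjTranspose_smul, smul_mulVec, -conjTranspose_apply, mul_comm]

theorem of_delta_sub_eq_one_sub {ι m n : Type*} [Fintype m] [Fintype n] [DecidableEq ι]
    (B : ι → Matrix m n ℂ) (β : m → ℂ) :
    (of fun i j => (if i = j then (1 : ℂ) else 0)
        - ∑ k, ((B i * (B j)ᴴ) *ᵥ β) k * (starRingEnd ℂ) (β k)) =
      1 - (of fun k j => ((B j)ᴴ *ᵥ β) k)ᴴ * of fun k j => ((B j)ᴴ *ᵥ β) k := by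
  ext i j
  have h : star ((B i)ᴴ *ᵥ β) ⬝ᵥ ((B j)ᴴ *ᵥ β) = ((B i * (B j)ᴴ) *ᵥ β) ⬝ᵥ star β := by
    rw [star_mulVec, conjTranspose_conjTranspose, ← dotProduct_mulVec, mulVec_mulVec,
      dotProduct_comm]
  simpa [Matrix.sub_apply, one_apply, mul_apply, dotProduct] using h.symm

/-- `‖∑ xⱼ Bⱼ‖ ≤ 1` for every `x` in the Euclidean unit ball of `ℂᵐ` iff for every unit
vector `β ∈ ℂⁿ` the `m × m` matrix with entries `δᵢⱼ − ⟨BᵢBⱼ* β, β⟩` is positive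
semidefinite. -/
theorem stmt18 {m n : ℕ} (B : Fin m → Matrix (Fin n) (Fin n) ℂ) :
    (∀ x : Fin m → ℂ, (∑ j, ‖x j‖ ^ 2) ≤ 1 →
        opNorm (∑ j, x j • B j) ≤ 1)
      ↔ (∀ β : Fin n → ℂ, (∑ i, ‖β i‖ ^ 2) = 1 →
          (Matrix.of fun i j : Fin m =>
              (if i = j then (1 : ℂ) else 0)
                - ∑ k, ((B i * (B j)ᴴ).mulVec β) k * (starRingEnd ℂ) (β k)).PosSemidef) := by
  have norm_sq {k : ℕ} (v : Fin k → ℂ) : ∑ i, ‖v i‖ ^ 2 = ‖WithLp.toLp 2 v‖ ^ 2 := by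
    simp [EuclideanSpace.norm_sq_eq]
  have norm_star (v : Fin m → ℂ) : ‖WithLp.toLp 2 (star v)‖ = ‖WithLp.toLp 2 v‖ := by
    simp [EuclideanSpace.norm_eq]
  simp only [of_delta_sub_eq_one_sub, posSemidef_one_sub_conjTranspose_mul_self_iff,
    of_conjTranspose_mulVec_mulVec, norm_sq, sq_le_one_iff₀ (norm_nonneg _),
    pow_eq_one_iff_of_nonneg (norm_nonneg _) two_ne_zero]
  constructor
  · intro h β hβ v
    rcases eq_or_ne v 0 with rfl | hv
    · simp
    have hv' : 0 < ‖WithLp.toLp 2 v‖ := by simpa using hv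
    have hx := h ((‖WithLp.toLp 2 v‖⁻¹ : ℂ) • star v) (by
      rw [WithLp.toLp_smul, norm_smul, norm_star]
      simp [hv'.ne'])
    rw [← opNorm_conjTranspose, opNorm_le_iff _ zero_le_one] at hx
    have hx' := hx (WithLp.toLp 2 β)
    simp only [Pi.smul_apply, smul_assoc, ← Finset.smul_sum, conjTranspose_smul, smul_mulVec,
      WithLp.toLp_smul, norm_smul, hβ] at hx'
    simpa [inv_mul_le_iff₀ hv'] using hx'
  · intro h x hx
    rw [← opNorm_conjTranspose, opNorm_le_iff _ zero_le_one]
    intro b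
    rcases eq_or_ne b 0 with rfl | hb
    · simp
    have hb' : 0 < ‖b‖ := by simpa using hb
    have hβ := h ((‖b‖⁻¹ : ℂ) • b.ofLp) (by
      rw [WithLp.toLp_smul, norm_smul]
      simp [hb'.ne']) (star x)
    rw [star_star, mulVec_smul, WithLp.toLp_smul, norm_smul, norm_star] at hβ
    have hβ' := hβ.trans hx
    simpa [inv_mul_le_iff₀ hb'] using hβ'
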